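/- (Parseval-type identities for the SQLCT on L².) Let A₁ = (a₁ b₁; c₁ d₁) and A₂ = (a₂ b₂; c₂ d₂) be real 2×2 matrices with det A₁ = det A₂ = 1 and b₁, b₂ ≠ 0, and let Φ_s : L²(ℝ²,ℍ) → L²(ℝ²,ℍ) be continuous with respect to the L² norm and agree almost everywhere with ℒ_s on L¹(ℝ²,ℍ) ∩ L²(ℝ²,ℍ). Then for all f, g ∈ L²(ℝ²,ℍ): ‖Φ_s f‖₂ = ‖f‖₂, Sc(⟨Φ_s f, Φ_s g⟩) = Sc(⟨f, g⟩), and Sc(i·⟨Φ_s f, Φ_s g⟩) = Sc(i·⟨f, g⟩). -/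

import Mathlib

open MeasureTheory Real ENNReal

noncomputable section

/-- The real quaternions. -/
abbrev Hq := Quaternion ℝ

/-- The imaginary unit `i`. -/
def qi : Hq := ⟨0,1,0,0⟩
/-- The imaginary unit `j`. -/
def qj : Hq := ⟨0,0,1,0⟩
/-- The imaginary unit `k`. -/
def qk : Hq := ⟨0,0,0,1⟩

/-- For a (unit pure imaginary) quaternion `u`, `e^{uθ} := cos θ + u sin θ`. -/
def qexp (u : Hq) (θ : ℝ) : Hq := (Real.cos θ) • (1 : Hq) + (Real.sin θ) • u

/-- The right-sided quaternion Fourier transform of `f ∈ L¹(ℝ²,ℍ)`. -/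
def Fr (f : ℝ × ℝ → Hq) (ω : ℝ × ℝ) : Hq :=
  (1 / (2 * Real.pi)) • ∫ x : ℝ × ℝ, f x * qexp qi (-(ω.1 * x.1)) * qexp qj (-(ω.2 * x.2))

/-- The two-sided quaternion Fourier transform of `f ∈ L¹(ℝ²,ℍ)`. -/
def Fs (f : ℝ × ℝ → Hq) (ω : ℝ × ℝ) : Hq :=
  (1 / (2 * Real.pi)) • ∫ x : ℝ × ℝ, qexp qi (-(ω.1 * x.1)) * f x * qexp qj (-(ω.2 * x.2))


/-- The LCT kernel K_A^u for a matrix A = (a b; c d) with b ≠ 0, evaluated at (x, ω). -/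
def Kker (u : Hq) (a b d : ℝ) (x ω : ℝ) : Hq :=
  (Real.sqrt (2 * Real.pi * |b|))⁻¹ •
    (qexp u (-(Real.pi * Real.sign b / 4)) *
      qexp u (a * x ^ 2 / (2 * b) - x * ω / b + d * ω ^ 2 / (2 * b)))

/-- The two-sided quaternion linear canonical transform (case b₁, b₂ ≠ 0). -/
def Ls (a1 b1 d1 a2 b2 d2 : ℝ) (f : ℝ × ℝ → Hq) (ω : ℝ × ℝ) : Hq :=
  ∫ x : ℝ × ℝ, Kker qi a1 b1 d1 x.1 ω.1 * f x * Kker qj a2 b2 d2 x.2 ω.2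

/-- The right-sided quaternion linear canonical transform (case b₁, b₂ ≠ 0). -/
def Lr (a1 b1 d1 a2 b2 d2 : ℝ) (f : ℝ × ℝ → Hq) (ω : ℝ × ℝ) : Hq :=
  ∫ x : ℝ × ℝ, f x * Kker qi a1 b1 d1 x.1 ω.1 * Kker qj a2 b2 d2 x.2 ω.2

open FourierTransform SchwartzMap ContDiff in
theorem aux_plancherel {E : Type*} [NormedAddCommGroup E] [InnerProductSpace ℝ E]
    [FiniteDimensional ℝ E] [MeasurableSpace E] [BorelSpace E]
    (h : E → ℂ) (h1 : Integrable h) (h2 : MemLp h 2) :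
    eLpNorm (𝓕 h) 2 volume = eLpNorm h 2 volume := by
  have hc : Continuous (𝓕 h) := VectorFourier.fourierIntegral_continuous
    Real.continuous_fourierChar (innerSL ℝ).continuous₂ h1
  set F : Lp ℂ 2 (volume : Measure E) := h2.toLp h with hF
  have key : ∀ᵐ x, (𝓕 F : Lp ℂ 2 (volume : Measure E)) x = 𝓕 h x := by
    apply ae_eq_of_integral_contDiff_smul_eq
    · exact (Lp.memLp _).locallyIntegrable (by norm_num)
    · exact hc.locallyIntegrable
    · intro g g_smooth g_cpt
      have hg₁ : HasCompactSupport (Complex.ofRealCLM ∘ g) := g_cpt.comp_left rfl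
      have hg₂ : ContDiff ℝ ∞ (Complex.ofRealCLM ∘ g) := by fun_prop
      set G : 𝓢(E, ℂ) := hg₁.toSchwartzMap hg₂ with hG
      have e1 : (𝓕 (F : 𝓢'(E, ℂ))) G = ((𝓕 F : Lp ℂ 2 (volume : Measure E)) : 𝓢'(E, ℂ)) G := by
        rw [Lp.fourier_toTemperedDistribution_eq]
      rw [TemperedDistribution.fourier_apply, Lp.toTemperedDistribution_apply,
        Lp.toTemperedDistribution_apply] at e1
      have e2 : ∫ x, (𝓕 G) x • F x = ∫ x, (𝓕 (G : E → ℂ)) x • h x := by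
        apply integral_congr_ae
        filter_upwards [h2.coeFn_toLp] with x hx
        rw [hF, hx, SchwartzMap.fourier_coe]
      have e3 := VectorFourier.integral_fourierIntegral_smul_eq_flip (L := innerₗ E)
        (μ := volume) (ν := volume) (f := (G : E → ℂ)) (g := h)
        Real.continuous_fourierChar continuous_inner G.integrable h1
      rw [flip_innerₗ] at e3
      have e4 : ∫ x, (𝓕 (G : E → ℂ)) x • h x = ∫ x, G x • 𝓕 h x := e3
      have e5 := e1.symm.trans (e2.trans e4)
      simpa [hG] using e5
  have n := Lp.norm_fourier_eq F
  rw [Lp.norm_def, Lp.norm_def, ENNReal.toReal_eq_toReal_iff' (Lp.eLpNorm_ne_top _)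
    (Lp.eLpNorm_ne_top _)] at n
  rw [← eLpNorm_congr_ae key, n]
  exact eLpNorm_congr_ae h2.coeFn_toLp

theorem aux_sq {α F : Type*} [MeasurableSpace α] [NormedAddCommGroup F] {μ : Measure α}
    (f : α → F) : ∫⁻ x, ‖f x‖ₑ ^ 2 ∂μ = eLpNorm f 2 μ ^ 2 := by
  have := eLpNorm_nnreal_pow_eq_lintegral (p := 2) (f := f) (μ := μ) (by norm_num)
  simpa using this.symm

theorem aux_scale (c1 c2 : ℝ) (h1 : c1 ≠ 0) (h2 : c2 ≠ 0) (F : ℝ × ℝ → ENNReal)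
    (hF : Measurable F) :
    ∫⁻ x : ℝ × ℝ, F (c1 * x.1, c2 * x.2) = ENNReal.ofReal |c1⁻¹ * c2⁻¹| * ∫⁻ x, F x := by
  have hm : Measurable (Prod.map (c1 * ·) (c2 * ·) : ℝ × ℝ → ℝ × ℝ) := by fun_prop
  have : Measure.map (Prod.map (c1 * ·) (c2 * ·) : ℝ × ℝ → ℝ × ℝ) volume
      = ENNReal.ofReal |c1⁻¹ * c2⁻¹| • volume := by
    rw [Measure.volume_eq_prod, ← Measure.map_prod_map _ _ (by fun_prop) (by fun_prop),
      Real.map_volume_mul_left h1, Real.map_volume_mul_left h2, Measure.prod_smul_left,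
      Measure.prod_smul_right, smul_smul, abs_mul, ENNReal.ofReal_mul (abs_nonneg _)]
  calc _ = ∫⁻ x, F x ∂(Measure.map (Prod.map (c1 * ·) (c2 * ·) : ℝ × ℝ → ℝ × ℝ) volume) := by
        rw [lintegral_map hF hm]; rfl
    _ = _ := by rw [this, lintegral_smul_measure, smul_eq_mul]

open FourierTransform in
theorem aux_fourier2 (b1 b2 : ℝ) (hb1 : b1 ≠ 0) (hb2 : b2 ≠ 0) (h : ℝ × ℝ → ℂ)
    (h1 : Integrable h) (h2 : MemLp h 2) :
    ∫⁻ ω : ℝ × ℝ, ‖∫ x : ℝ × ℝ, Complex.exp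
        (((-(x.1 * ω.1 / b1) - x.2 * ω.2 / b2 : ℝ) : ℂ) * Complex.I) * h x‖ₑ ^ 2
      = ENNReal.ofReal ((2 * π) ^ 2 * |b1 * b2|) * ∫⁻ x, ‖h x‖ₑ ^ 2 := by
  let V := WithLp 2 (ℝ × ℝ)
  have mp : MeasurePreserving (WithLp.ofLp : V → ℝ × ℝ) := WithLp.volume_preserving_ofLp ℝ ℝ
  have mp' : MeasurePreserving (WithLp.toLp 2 : ℝ × ℝ → V) := WithLp.volume_preserving_toLp ℝ ℝ
  have me : MeasurableEmbedding (WithLp.ofLp : V → ℝ × ℝ) :=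
    (MeasurableEquiv.toLp 2 (ℝ × ℝ)).symm.measurableEmbedding
  have me' : MeasurableEmbedding (WithLp.toLp 2 : ℝ × ℝ → V) :=
    (MeasurableEquiv.toLp 2 (ℝ × ℝ)).measurableEmbedding
  let H : V → ℂ := fun v => h v.ofLp
  have H1 : Integrable H := mp.integrable_comp_of_integrable h1
  have H2 : MemLp H 2 := h2.comp_measurePreserving mp
  have hc : Continuous (𝓕 H) := VectorFourier.fourierIntegral_continuous
    Real.continuous_fourierChar (innerSL ℝ).continuous₂ H1
  have P := aux_plancherel H H1 H2
  let G : ℝ × ℝ → ENNReal := fun y => ‖𝓕 H (WithLp.toLp 2 y)‖ₑ ^ 2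
  have hG : Measurable G := by
    have : Measurable (fun y : ℝ × ℝ => 𝓕 H (WithLp.toLp 2 y)) :=
      hc.measurable.comp me'.measurable
    exact (this.enorm).pow_const 2
  have e1 : ∀ ω : ℝ × ℝ, ‖∫ x : ℝ × ℝ, Complex.exp
        (((-(x.1 * ω.1 / b1) - x.2 * ω.2 / b2 : ℝ) : ℂ) * Complex.I) * h x‖ₑ ^ 2
        = G ((2 * π * b1)⁻¹ * ω.1, (2 * π * b2)⁻¹ * ω.2) := by
    intro ω
    simp only [G]
    congr 2
    rw [Real.fourier_eq', ← mp.integral_comp me]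
    apply integral_congr_ae
    refine Filter.Eventually.of_forall fun v => ?_
    simp only [smul_eq_mul, H]
    congr 4
    rw [WithLp.prod_inner_apply]
    simp only [RCLike.inner_apply, conj_trivial]
    field_simp
    ring
  simp_rw [e1]
  have hpi := Real.pi_ne_zero
  rw [aux_scale _ _ (by positivity) (by positivity) G hG]
  congr 1
  · congr 1
    simp only [inv_inv]
    rw [show 2 * π * b1 * (2 * π * b2) = (2 * π) ^ 2 * (b1 * b2) by ring, abs_mul,
      abs_of_nonneg (by positivity : (0:ℝ) ≤ (2 * π) ^ 2)]
  · simp only [G]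
    rw [mp'.lintegral_comp_emb me' (fun v => ‖𝓕 H v‖ₑ ^ 2), aux_sq, P, ← aux_sq]
    exact mp.lintegral_comp_emb me (fun v => ‖h v‖ₑ ^ 2)

/-- Unit complex number `e^{iθ}`. -/
def aux_ce (θ : ℝ) : ℂ := Complex.exp ((θ : ℂ) * Complex.I)

theorem aux_ce_add (s t : ℝ) : aux_ce (s + t) = aux_ce s * aux_ce t := by
  simp only [aux_ce, ← Complex.exp_add]; push_cast; ring_nf

theorem aux_ce_norm (s : ℝ) : ‖aux_ce s‖ = 1 := Complex.norm_exp_ofReal_mul_I s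

/-- The complex linear canonical kernel. -/
def aux_ck (a b d x ω : ℝ) : ℂ :=
  (((Real.sqrt (2 * π * |b|))⁻¹ : ℝ) : ℂ) * (aux_ce (-(π * Real.sign b / 4)) *
    aux_ce (a * x ^ 2 / (2 * b) - x * ω / b + d * ω ^ 2 / (2 * b)))

theorem aux_lct (a1 b1 d1 a2 b2 d2 : ℝ) (hb1 : b1 ≠ 0) (hb2 : b2 ≠ 0) (h : ℝ × ℝ → ℂ)
    (h1 : Integrable h) (h2 : MemLp h 2) :
    ∫⁻ ω : ℝ × ℝ, ‖∫ x : ℝ × ℝ, aux_ck a1 b1 d1 x.1 ω.1 * aux_ck a2 b2 d2 x.2 ω.2 * h x‖ₑ ^ 2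
      = ∫⁻ x, ‖h x‖ₑ ^ 2 := by
  let p : ℝ × ℝ → ℂ := fun x => aux_ce (a1 * x.1 ^ 2 / (2 * b1) + a2 * x.2 ^ 2 / (2 * b2))
  have hp : Continuous p := by simp only [p, aux_ce]; fun_prop
  have pn : ∀ x, ‖p x‖ = 1 := fun x => aux_ce_norm _
  let h' : ℝ × ℝ → ℂ := fun x => p x * h x
  have hn : ∀ x, ‖h' x‖ = ‖h x‖ := fun x => by simp [h', pn]
  have hm : AEStronglyMeasurable h' volume :=
    hp.aestronglyMeasurable.mul h1.aestronglyMeasurable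
  have h1' : Integrable h' :=
    h1.congr' hm (Filter.Eventually.of_forall fun x => (hn x).symm)
  have h2' : MemLp h' 2 :=
    (memLp_congr_norm hm h1.aestronglyMeasurable (Filter.Eventually.of_forall hn)).2 h2
  have F := aux_fourier2 b1 b2 hb1 hb2 h' h1' h2'
  let r : ℝ := (Real.sqrt (2 * π * |b1|))⁻¹ * (Real.sqrt (2 * π * |b2|))⁻¹
  have e : ∀ ω : ℝ × ℝ,
      ‖∫ x : ℝ × ℝ, aux_ck a1 b1 d1 x.1 ω.1 * aux_ck a2 b2 d2 x.2 ω.2 * h x‖ₑ ^ 2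
      = ENNReal.ofReal (r ^ 2) * ‖∫ x : ℝ × ℝ, Complex.exp
        (((-(x.1 * ω.1 / b1) - x.2 * ω.2 / b2 : ℝ) : ℂ) * Complex.I) * h' x‖ₑ ^ 2 := by
    intro ω
    let C : ℂ := (r : ℂ) * aux_ce (-(π * Real.sign b1 / 4) + -(π * Real.sign b2 / 4) +
      d1 * ω.1 ^ 2 / (2 * b1) + d2 * ω.2 ^ 2 / (2 * b2))
    have : ∀ x : ℝ × ℝ, aux_ck a1 b1 d1 x.1 ω.1 * aux_ck a2 b2 d2 x.2 ω.2 * h x =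
        C * (Complex.exp (((-(x.1 * ω.1 / b1) - x.2 * ω.2 / b2 : ℝ) : ℂ) * Complex.I) * h' x) := by
      intro x
      change _ = C * (aux_ce _ * (p x * h x))
      simp only [aux_ck, C, p, r, sub_eq_add_neg, aux_ce_add]
      push_cast
      ring
    simp_rw [this]
    rw [integral_const_mul, enorm_mul, mul_pow]
    congr 1
    rw [← ofReal_norm, norm_mul, aux_ce_norm, mul_one, Complex.norm_real, Real.norm_eq_abs,
      ← ENNReal.ofReal_pow (abs_nonneg _), sq_abs]
  simp_rw [e]
  rw [lintegral_const_mul' _ _ ENNReal.ofReal_ne_top, F, ← mul_assoc,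
    ← ENNReal.ofReal_mul (by positivity)]
  have hr : r ^ 2 * ((2 * π) ^ 2 * |b1 * b2|) = 1 := by
    have := Real.pi_pos
    have := abs_pos.2 hb1
    have := abs_pos.2 hb2
    simp only [r, mul_pow, inv_pow]
    rw [Real.sq_sqrt (by positivity), Real.sq_sqrt (by positivity), abs_mul]
    field_simp
  rw [hr, ENNReal.ofReal_one, one_mul]
  refine lintegral_congr fun x => ?_
  rw [← ofReal_norm, hn, ofReal_norm]

/-- First complex coordinate of a quaternion, along `1 + k`. -/
def aux_P : Hq →L[ℝ] ℂ := LinearMap.toContinuousLinearMap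
  { toFun := fun q => ⟨(q.re + q.imK) / 2, (q.imI - q.imJ) / 2⟩
    map_add' := by intro x y; apply Complex.ext <;> simp <;> ring
    map_smul' := by intro x y; apply Complex.ext <;> simp <;> ring }

/-- Second complex coordinate of a quaternion, along `1 - k`. -/
def aux_M : Hq →L[ℝ] ℂ := LinearMap.toContinuousLinearMap
  { toFun := fun q => ⟨(q.re - q.imK) / 2, (q.imI + q.imJ) / 2⟩
    map_add' := by intro x y; apply Complex.ext <;> simp <;> ring
    map_smul' := by intro x y; apply Complex.ext <;> simp <;> ring }

theorem aux_P_apply (q : Hq) : aux_P q = ⟨(q.re + q.imK) / 2, (q.imI - q.imJ) / 2⟩ := rfl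

theorem aux_M_apply (q : Hq) : aux_M q = ⟨(q.re - q.imK) / 2, (q.imI + q.imJ) / 2⟩ := rfl

theorem aux_norm_split (q : Hq) : ‖q‖ₑ ^ 2 = 2 * ‖aux_P q‖ₑ ^ 2 + 2 * ‖aux_M q‖ₑ ^ 2 := by
  have h : ‖q‖ ^ 2 = 2 * ‖aux_P q‖ ^ 2 + 2 * ‖aux_M q‖ ^ 2 := by
    rw [Complex.sq_norm, Complex.sq_norm, sq, ← Quaternion.normSq_eq_norm_mul_self,
      Quaternion.normSq_def', aux_P_apply, aux_M_apply]
    simp only [Complex.normSq_mk]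
    ring
  simp only [← ofReal_norm]
  rw [← ENNReal.ofReal_pow (norm_nonneg _), h, ENNReal.ofReal_add (by positivity) (by positivity),
    ENNReal.ofReal_mul (by positivity), ENNReal.ofReal_mul (by positivity),
    ENNReal.ofReal_pow (norm_nonneg _), ENNReal.ofReal_pow (norm_nonneg _)]
  simp

theorem aux_ce_mk (s : ℝ) : aux_ce s = ⟨Real.cos s, Real.sin s⟩ := by
  apply Complex.ext
  · simp [aux_ce, Complex.exp_ofReal_mul_I_re]
  · simp [aux_ce, Complex.exp_ofReal_mul_I_im]

theorem aux_one_re : (1 : Hq).re = 1 := rfl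

theorem aux_one_imI : (1 : Hq).imI = 0 := rfl

theorem aux_one_imJ : (1 : Hq).imJ = 0 := rfl

theorem aux_one_imK : (1 : Hq).imK = 0 := rfl

theorem aux_qi_re : qi.re = 0 := rfl

theorem aux_qi_imI : qi.imI = 1 := rfl

theorem aux_qi_imJ : qi.imJ = 0 := rfl

theorem aux_qi_imK : qi.imK = 0 := rfl

theorem aux_ei_re (s : ℝ) : (qexp qi s).re = Real.cos s := by
  simp [qexp, aux_qi_re, aux_one_re]

theorem aux_ei_imI (s : ℝ) : (qexp qi s).imI = Real.sin s := by
  simp [qexp, aux_qi_imI, aux_one_imI]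

theorem aux_ei_imJ (s : ℝ) : (qexp qi s).imJ = 0 := by
  simp [qexp, aux_qi_imJ, aux_one_imJ]

theorem aux_ei_imK (s : ℝ) : (qexp qi s).imK = 0 := by
  simp [qexp, aux_qi_imK, aux_one_imK]

theorem aux_qj_re : qj.re = 0 := rfl

theorem aux_qj_imI : qj.imI = 0 := rfl

theorem aux_qj_imJ : qj.imJ = 1 := rfl

theorem aux_qj_imK : qj.imK = 0 := rfl

theorem aux_ej_re (s : ℝ) : (qexp qj s).re = Real.cos s := by
  simp [qexp, aux_qj_re, aux_one_re]

theorem aux_ej_imI (s : ℝ) : (qexp qj s).imI = 0 := by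
  simp [qexp, aux_qj_imI, aux_one_imI]

theorem aux_ej_imJ (s : ℝ) : (qexp qj s).imJ = Real.sin s := by
  simp [qexp, aux_qj_imJ, aux_one_imJ]

theorem aux_ej_imK (s : ℝ) : (qexp qj s).imK = 0 := by
  simp [qexp, aux_qj_imK, aux_one_imK]

theorem aux_P_i (s : ℝ) (q : Hq) : aux_P (qexp qi s * q) = aux_ce s * aux_P q := by
  rw [aux_ce_mk, aux_P_apply, aux_P_apply]
  apply Complex.ext <;>
    simp [aux_ei_re, aux_ei_imI, aux_ei_imJ, aux_ei_imK] <;> ring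

theorem aux_M_i (s : ℝ) (q : Hq) : aux_M (qexp qi s * q) = aux_ce s * aux_M q := by
  rw [aux_ce_mk, aux_M_apply, aux_M_apply]
  apply Complex.ext <;>
    simp [aux_ei_re, aux_ei_imI, aux_ei_imJ, aux_ei_imK] <;> ring

theorem aux_P_j (s : ℝ) (q : Hq) : aux_P (q * qexp qj s) = aux_ce (-s) * aux_P q := by
  rw [aux_ce_mk, aux_P_apply, aux_P_apply]
  apply Complex.ext <;>
    simp [aux_ej_re, aux_ej_imI, aux_ej_imJ, aux_ej_imK] <;> ring

theorem aux_M_j (s : ℝ) (q : Hq) : aux_M (q * qexp qj s) = aux_ce s * aux_M q := by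
  rw [aux_ce_mk, aux_M_apply, aux_M_apply]
  apply Complex.ext <;>
    simp [aux_ej_re, aux_ej_imI, aux_ej_imJ, aux_ej_imK] <;> ring

theorem aux_P_ker (a1 b1 d1 a2 b2 d2 x1 w1 x2 w2 : ℝ) (q : Hq) :
    aux_P (Kker qi a1 b1 d1 x1 w1 * q * Kker qj a2 b2 d2 x2 w2) =
      aux_ck a1 b1 d1 x1 w1 * aux_ck a2 (-b2) d2 x2 w2 * aux_P q := by
  simp only [Kker, smul_mul_assoc, mul_smul_comm, map_smul, mul_assoc, aux_P_i]
  rw [← mul_assoc q, aux_P_j, aux_P_j]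
  simp only [aux_ck, abs_neg, Complex.real_smul, Real.sign_neg]
  rw [show -(π * -Real.sign b2 / 4) = - -(π * Real.sign b2 / 4) by ring,
    show a2 * x2 ^ 2 / (2 * -b2) - x2 * w2 / -b2 + d2 * w2 ^ 2 / (2 * -b2) =
    -(a2 * x2 ^ 2 / (2 * b2) - x2 * w2 / b2 + d2 * w2 ^ 2 / (2 * b2)) by
      rw [mul_neg, div_neg, div_neg, div_neg]; ring]
  ring

theorem aux_M_ker (a1 b1 d1 a2 b2 d2 x1 w1 x2 w2 : ℝ) (q : Hq) :
    aux_M (Kker qi a1 b1 d1 x1 w1 * q * Kker qj a2 b2 d2 x2 w2) =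
      aux_ck a1 b1 d1 x1 w1 * aux_ck a2 b2 d2 x2 w2 * aux_M q := by
  simp only [Kker, smul_mul_assoc, mul_smul_comm, map_smul, mul_assoc, aux_M_i]
  rw [← mul_assoc q, aux_M_j, aux_M_j]
  simp only [aux_ck, Complex.real_smul]
  ring

theorem aux_qexp_norm_i (s : ℝ) : ‖qexp qi s‖ = 1 := by
  have : ‖qexp qi s‖ ^ 2 = 1 := by
    rw [sq, ← Quaternion.normSq_eq_norm_mul_self, Quaternion.normSq_def', aux_ei_re, aux_ei_imI, aux_ei_imJ, aux_ei_imK]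
    simp
  nlinarith [norm_nonneg (qexp qi s)]

theorem aux_qexp_norm_j (s : ℝ) : ‖qexp qj s‖ = 1 := by
  have : ‖qexp qj s‖ ^ 2 = 1 := by
    rw [sq, ← Quaternion.normSq_eq_norm_mul_self, Quaternion.normSq_def', aux_ej_re, aux_ej_imI, aux_ej_imJ, aux_ej_imK]
    simp
  nlinarith [norm_nonneg (qexp qj s)]

theorem aux_integrable (a1 b1 d1 a2 b2 d2 : ℝ) (f : ℝ × ℝ → Hq) (hf : Integrable f) (ω : ℝ × ℝ) :
    Integrable (fun x : ℝ × ℝ => Kker qi a1 b1 d1 x.1 ω.1 * f x * Kker qj a2 b2 d2 x.2 ω.2) := by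
  have c1 : Continuous fun x : ℝ × ℝ => Kker qi a1 b1 d1 x.1 ω.1 := by
    simp only [Kker, qexp]; fun_prop
  have c2 : Continuous fun x : ℝ × ℝ => Kker qj a2 b2 d2 x.2 ω.2 := by
    simp only [Kker, qexp]; fun_prop
  refine Integrable.mono' (hf.norm.const_mul
    (|(Real.sqrt (2 * π * |b1|))⁻¹| * |(Real.sqrt (2 * π * |b2|))⁻¹|))
    ((c1.aestronglyMeasurable.mul hf.aestronglyMeasurable).mul c2.aestronglyMeasurable)
    (Filter.Eventually.of_forall fun x => le_of_eq ?_)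
  simp only [Kker, norm_mul, norm_smul, aux_qexp_norm_i, aux_qexp_norm_j, Real.norm_eq_abs]
  ring

theorem aux_Ls_plancherel (a1 b1 d1 a2 b2 d2 : ℝ) (hb1 : b1 ≠ 0) (hb2 : b2 ≠ 0)
    (f : ℝ × ℝ → Hq) (h1 : Integrable f) (h2 : MemLp f 2)
    (hm : AEStronglyMeasurable (Ls a1 b1 d1 a2 b2 d2 f) volume) :
    eLpNorm (Ls a1 b1 d1 a2 b2 d2 f) 2 volume = eLpNorm f 2 volume := by
  have hP : ∀ ω, aux_P (Ls a1 b1 d1 a2 b2 d2 f ω) = ∫ x : ℝ × ℝ,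
      aux_ck a1 b1 d1 x.1 ω.1 * aux_ck a2 (-b2) d2 x.2 ω.2 * aux_P (f x) := by
    intro ω
    rw [Ls, ← ContinuousLinearMap.integral_comp_comm _ (aux_integrable _ _ _ _ _ _ f h1 ω)]
    simp_rw [aux_P_ker]
  have hM : ∀ ω, aux_M (Ls a1 b1 d1 a2 b2 d2 f ω) = ∫ x : ℝ × ℝ,
      aux_ck a1 b1 d1 x.1 ω.1 * aux_ck a2 b2 d2 x.2 ω.2 * aux_M (f x) := by
    intro ω
    rw [Ls, ← ContinuousLinearMap.integral_comp_comm _ (aux_integrable _ _ _ _ _ _ f h1 ω)]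
    simp_rw [aux_M_ker]
  have split : ∀ g : ℝ × ℝ → Hq, AEStronglyMeasurable g volume → ∫⁻ x, ‖g x‖ₑ ^ 2 =
      2 * (∫⁻ x, ‖aux_P (g x)‖ₑ ^ 2) + 2 * ∫⁻ x, ‖aux_M (g x)‖ₑ ^ 2 := by
    intro g hg
    simp_rw [aux_norm_split]
    have m : AEMeasurable (fun x => 2 * ‖aux_P (g x)‖ₑ ^ 2) volume :=
      ((aux_P.continuous.comp_aestronglyMeasurable hg).enorm.pow_const 2).const_mul 2
    rw [lintegral_add_left' m, lintegral_const_mul' _ _ (by simp),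
      lintegral_const_mul' _ _ (by simp)]
  have main : ∫⁻ x, ‖Ls a1 b1 d1 a2 b2 d2 f x‖ₑ ^ 2 = ∫⁻ x, ‖f x‖ₑ ^ 2 := by
    rw [split _ hm, split _ h1.aestronglyMeasurable]
    simp_rw [hP, hM]
    rw [aux_lct a1 b1 d1 a2 (-b2) d2 hb1 (neg_ne_zero.2 hb2) (fun x => aux_P (f x))
        (aux_P.integrable_comp h1) (aux_P.comp_memLp' h2),
      aux_lct a1 b1 d1 a2 b2 d2 hb1 hb2 (fun x => aux_M (f x))
        (aux_M.integrable_comp h1) (aux_M.comp_memLp' h2)]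
  rw [aux_sq, aux_sq] at main
  exact (ENNReal.pow_right_strictMono (n := 2) (by norm_num)).injective main

/-- Left multiplication by `i`. -/
def aux_L : Hq →L[ℝ] Hq := ContinuousLinearMap.mul ℝ Hq qi

theorem aux_L_apply (q : Hq) : aux_L q = qi * q := rfl

theorem aux_i_comm (s : ℝ) : qexp qi s * qi = qi * qexp qi s := by
  simp [qexp, mul_add, add_mul]

theorem aux_Kker_comm (a b d x w : ℝ) : Kker qi a b d x w * qi = qi * Kker qi a b d x w := by
  simp only [Kker, smul_mul_assoc, mul_smul_comm]
  rw [mul_assoc (qexp qi _), aux_i_comm, ← mul_assoc, aux_i_comm, mul_assoc qi]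

theorem aux_int_mul (F G : Lp Hq 2 (volume : Measure (ℝ × ℝ))) :
    Integrable (fun x => F x * star (G x)) := by
  have hG : MemLp (fun x => star (G x)) 2 volume := (Lp.memLp G).star
  exact (Lp.memLp F).integrable_mul hG

theorem aux_re (F G : Lp Hq 2 (volume : Measure (ℝ × ℝ))) :
    (∫ x : ℝ × ℝ, F x * star (G x)).re = inner ℝ F G := by
  let R : Hq →L[ℝ] ℝ := LinearMap.toContinuousLinearMap
    { toFun := fun q => q.re, map_add' := fun x y => by simp, map_smul' := fun x y => by simp }
  change R _ = _
  rw [← R.integral_comp_comm (aux_int_mul F G), L2.inner_def]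
  rfl

theorem aux_re_i (F G : Lp Hq 2 (volume : Measure (ℝ × ℝ))) :
    (qi * ∫ x : ℝ × ℝ, F x * star (G x)).re = inner ℝ (aux_L.compLp F) G := by
  rw [← aux_re, ← aux_L_apply, ← aux_L.integral_comp_comm (aux_int_mul F G)]
  refine congrArg (fun q : Hq => q.re) ?_
  apply integral_congr_ae
  filter_upwards [aux_L.coeFn_compLp F] with x hx
  rw [hx, aux_L_apply, aux_L_apply, mul_assoc]
theorem stmt15 (a1 b1 c1 d1 a2 b2 c2 d2 : ℝ)
    (hA1 : a1 * d1 - b1 * c1 = 1) (hA2 : a2 * d2 - b2 * c2 = 1)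
    (hb1 : b1 ≠ 0) (hb2 : b2 ≠ 0)
    (Φ : Lp Hq 2 (volume : Measure (ℝ × ℝ)) → Lp Hq 2 (volume : Measure (ℝ × ℝ)))
    (hcont : Continuous Φ)
    (hagree : ∀ f : Lp Hq 2 (volume : Measure (ℝ × ℝ)),
      Integrable (f : ℝ × ℝ → Hq) →
        (Φ f : ℝ × ℝ → Hq) =ᵐ[volume] Ls a1 b1 d1 a2 b2 d2 f)
    (f g : Lp Hq 2 (volume : Measure (ℝ × ℝ))) :
    ‖Φ f‖ = ‖f‖ ∧
    (∫ ω : ℝ × ℝ, (Φ f) ω * star ((Φ g) ω)).re = (∫ x : ℝ × ℝ, f x * star (g x)).re ∧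
    (qi * ∫ ω : ℝ × ℝ, (Φ f) ω * star ((Φ g) ω)).re =
      (qi * ∫ x : ℝ × ℝ, f x * star (g x)).re := by
  have hd : DenseRange (SchwartzMap.toLpCLM ℝ (E := ℝ × ℝ) Hq 2 (volume : Measure (ℝ × ℝ))) :=
    SchwartzMap.denseRange_toLpCLM ENNReal.ofNat_ne_top
  have hInteg : ∀ s : SchwartzMap (ℝ × ℝ) Hq,
      Integrable (SchwartzMap.toLpCLM ℝ (E := ℝ × ℝ) Hq 2 (volume : Measure (ℝ × ℝ)) s) := by
    intro s
    exact (integrable_congr (s.coeFn_toLp 2 volume)).2 s.integrable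
  have hnorm : ∀ f, ‖Φ f‖ = ‖f‖ := by
    intro f
    refine hd.induction_on (p := fun f => ‖Φ f‖ = ‖f‖) f
      (isClosed_eq hcont.norm continuous_norm) fun s => ?_
    have hs := hInteg s
    set F := SchwartzMap.toLpCLM ℝ (E := ℝ × ℝ) Hq 2 (volume : Measure (ℝ × ℝ)) s
    have h := hagree F hs
    rw [Lp.norm_def, Lp.norm_def, eLpNorm_congr_ae h, aux_Ls_plancherel a1 b1 d1 a2 b2 d2 hb1 hb2
      F hs (Lp.memLp F) ((Lp.aestronglyMeasurable (Φ F)).congr h)]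
  have hadd : ∀ f g, Φ (f + g) = Φ f + Φ g := by
    intro f g
    refine hd.induction_on₂ (p := fun f g => Φ (f + g) = Φ f + Φ g) ?_ ?_ f g
    · exact isClosed_eq (hcont.comp (continuous_fst.add continuous_snd))
        ((hcont.comp continuous_fst).add (hcont.comp continuous_snd))
    · intro s t
      have hs := hInteg s
      have ht := hInteg t
      set F := SchwartzMap.toLpCLM ℝ (E := ℝ × ℝ) Hq 2 (volume : Measure (ℝ × ℝ)) s
      set G := SchwartzMap.toLpCLM ℝ (E := ℝ × ℝ) Hq 2 (volume : Measure (ℝ × ℝ)) t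
      have hst : Integrable (F + G : Lp Hq 2 (volume : Measure (ℝ × ℝ))) :=
        (integrable_congr (Lp.coeFn_add F G)).2 (hs.add ht)
      apply Lp.ext
      filter_upwards [hagree _ hst, hagree _ hs, hagree _ ht, Lp.coeFn_add (Φ F) (Φ G)]
        with ω e1 e2 e3 e4
      rw [e4, Pi.add_apply, e1, e2, e3, Ls, Ls, Ls,
        ← integral_add (aux_integrable _ _ _ _ _ _ _ hs ω) (aux_integrable _ _ _ _ _ _ _ ht ω)]
      apply integral_congr_ae
      filter_upwards [Lp.coeFn_add F G] with x hx
      rw [hx, Pi.add_apply, mul_add, add_mul]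
  have hi : ∀ f, Φ (aux_L.compLp f) = aux_L.compLp (Φ f) := by
    intro f
    have cL : Continuous fun f : Lp Hq 2 (volume : Measure (ℝ × ℝ)) => aux_L.compLp f :=
      (aux_L.compLpL 2 volume).continuous
    refine hd.induction_on (p := fun f => Φ (aux_L.compLp f) = aux_L.compLp (Φ f)) f
      (isClosed_eq (hcont.comp cL) (cL.comp hcont)) fun s => ?_
    have hs := hInteg s
    set F := SchwartzMap.toLpCLM ℝ (E := ℝ × ℝ) Hq 2 (volume : Measure (ℝ × ℝ)) s
    have hs' : Integrable (aux_L.compLp F) :=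
      (integrable_congr (aux_L.coeFn_compLp F)).2 (aux_L.integrable_comp hs)
    apply Lp.ext
    filter_upwards [hagree _ hs, hagree _ hs', aux_L.coeFn_compLp (Φ F)] with ω e1 e2 e3
    rw [e3, e1, e2, Ls, Ls,
      ← aux_L.integral_comp_comm (aux_integrable _ _ _ _ _ _ _ hs ω)]
    apply integral_congr_ae
    filter_upwards [aux_L.coeFn_compLp F] with x hx
    rw [hx, aux_L_apply, aux_L_apply, ← mul_assoc, ← mul_assoc, ← mul_assoc, aux_Kker_comm]
  have hinner : ∀ f g, inner ℝ (Φ f) (Φ g) = inner ℝ f g := by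
    intro f g
    have h1 := norm_add_sq_real (Φ f) (Φ g)
    have h2 := norm_add_sq_real f g
    rw [← hadd, hnorm, hnorm, hnorm] at h1
    linarith
  refine ⟨hnorm f, ?_, ?_⟩
  · rw [aux_re, aux_re, hinner]
  · rw [aux_re_i, aux_re_i, ← hi, hinner]
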